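/- Let μ be the Borel measure on ℝ³ obtained as the pushforward, under the map (u₁,u₂) ↦ (u₁, u₂, √(u₁²+u₂²)), of the measure on ℝ² \ {0} with density (u₁,u₂) ↦ 1/√(u₁²+u₂²) with respect to Lebesgue measure (so μ is supported on the upper light cone). If L : ℝ³ → ℝ³ is a linear map satisfying B(Lx, Ly) = B(x,y) for all x, y ∈ ℝ³ and mapping the upper light cone { ξ : B(ξ,ξ)=0, ξ₃>0 } into itself, then the pushforward of μ under L equals μ. -/

import Mathlib

open MeasureTheory

/-- The Lorentzian bilinear form `B(x,y) = −x₁y₁ − x₂y₂ + x₃y₃` on `ℝ³`. -/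
def lorB (x y : Fin 3 → ℝ) : ℝ := -(x 0 * y 0) - x 1 * y 1 + x 2 * y 2

/-- The measure on `ℝ³` corresponding to the area form `(dξ₁ ∧ dξ₂)/ξ₃` on the upper
light cone: the pushforward, under `(u₁,u₂) ↦ (u₁, u₂, √(u₁²+u₂²))`, of the measure on
`ℝ² \ {0}` with density `1/√(u₁²+u₂²)` with respect to Lebesgue measure. -/
noncomputable def horoMeasure : Measure (Fin 3 → ℝ) :=
  Measure.map (fun u : ℝ × ℝ => ![u.1, u.2, Real.sqrt (u.1 ^ 2 + u.2 ^ 2)])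
    ((((volume : Measure (ℝ × ℝ)).restrict {u : ℝ × ℝ | u ≠ 0}).withDensity
      fun u : ℝ × ℝ => ENNReal.ofReal (1 / Real.sqrt (u.1 ^ 2 + u.2 ^ 2))))

/-- The last row of cofactors of a Lorentz matrix is, up to a sign, its last row reflected. -/
lemma lorentz_cofactors (M : Matrix (Fin 3) (Fin 3) ℝ)
    (hM : M.transpose * Matrix.diagonal ![-1, -1, 1] * M = Matrix.diagonal ![-1, -1, 1]) :
    |M.det| = 1 ∧
      M 0 0 * M 1 1 - M 0 1 * M 1 0 = M.det * M 2 2 ∧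
      M 0 1 * M 1 2 - M 0 2 * M 1 1 = -(M.det * M 2 0) ∧
      M 0 2 * M 1 0 - M 0 0 * M 1 2 = -(M.det * M 2 1) := by
  set J : Matrix (Fin 3) (Fin 3) ℝ := Matrix.diagonal ![-1, -1, 1] with hJ
  have hJJ : J * J = 1 := by
    rw [hJ, Matrix.diagonal_mul_diagonal, ← Matrix.diagonal_one]
    congr 1
    funext i
    fin_cases i <;> simp
  have hdet : |M.det| = 1 := by
    have h := congrArg Matrix.det hM
    have hJd : J.det = 1 := by simp [hJ, Fin.prod_univ_three]
    rw [Matrix.det_mul, Matrix.det_mul, Matrix.det_transpose, hJd] at h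
    have h2 : M.det ^ 2 = 1 := by linarith
    exact (pow_eq_one_iff_of_nonneg (abs_nonneg _) two_ne_zero).1 ((sq_abs _).trans h2)
  have hinv : (J * M.transpose * J) * M = 1 := by
    rw [Matrix.mul_assoc, Matrix.mul_assoc, ← Matrix.mul_assoc M.transpose, hM, hJJ]
  have hadj : M.adjugate = M.det • (J * M.transpose * J) := by
    calc M.adjugate = (J * M.transpose * J) * M * M.adjugate := by rw [hinv, Matrix.one_mul]
      _ = _ := by rw [Matrix.mul_assoc, Matrix.mul_adjugate]; simp
  have key : ∀ i j, M.adjugate i j = M.det * (![-1, -1, 1] i * M j i * ![-1, -1, 1] j) := by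
    intro i j
    rw [hadj, hJ, Matrix.smul_apply, Matrix.mul_diagonal, Matrix.diagonal_mul]
    simp
  rw [Matrix.adjugate_fin_three] at key
  have h0 := key 0 2
  have h1 := key 1 2
  have h2 := key 2 2
  simp at h0 h1 h2
  refine ⟨hdet, ?_, ?_, ?_⟩ <;> linarith

/-- The upper light cone as a graph over the plane. -/
noncomputable def coneLift (u : ℝ × ℝ) : Fin 3 → ℝ := ![u.1, u.2, Real.sqrt (u.1 ^ 2 + u.2 ^ 2)]

lemma measurable_coneLift : Measurable coneLift := by
  refine measurable_pi_iff.2 fun i => ?_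
  fin_cases i <;> simp [coneLift] <;> fun_prop

lemma sq_add_sq_pos_of_ne_zero {u : ℝ × ℝ} (hu : u ≠ 0) : 0 < u.1 ^ 2 + u.2 ^ 2 := by
  by_contra! h
  exact hu (Prod.ext (by simp; nlinarith [sq_nonneg u.1, sq_nonneg u.2])
    (by simp; nlinarith [sq_nonneg u.1, sq_nonneg u.2]))

lemma lorB_coneLift (u : ℝ × ℝ) : lorB (coneLift u) (coneLift u) = 0 := by
  have := Real.mul_self_sqrt (add_nonneg (sq_nonneg u.1) (sq_nonneg u.2))
  simp [lorB, coneLift]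
  linarith

lemma coneLift_two_pos {u : ℝ × ℝ} (hu : u ≠ 0) : 0 < coneLift u 2 := by
  simpa [coneLift] using Real.sqrt_pos.2 (sq_add_sq_pos_of_ne_zero hu)

lemma coneLift_eq {x : Fin 3 → ℝ} (hx : lorB x x = 0) (h2 : 0 ≤ x 2) :
    coneLift (x 0, x 1) = x := by
  have : Real.sqrt (x 0 ^ 2 + x 1 ^ 2) = x 2 := by
    rw [show x 0 ^ 2 + x 1 ^ 2 = x 2 ^ 2 by simp only [lorB] at hx; linarith, Real.sqrt_sq h2]
  funext i
  fin_cases i <;> simp [coneLift, this]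

lemma ne_zero_of_lorB_eq_zero {x : Fin 3 → ℝ} (hx : lorB x x = 0) (h2 : x 2 ≠ 0) :
    (x 0, x 1) ≠ (0 : ℝ × ℝ) := by
  intro h
  simp only [Prod.mk_eq_zero] at h
  simp [lorB, h.1, h.2, h2] at hx

lemma lorentz_injective {L : (Fin 3 → ℝ) →ₗ[ℝ] (Fin 3 → ℝ)}
    (hL : ∀ x y : Fin 3 → ℝ, lorB (L x) (L y) = lorB x y) : Function.Injective L := by
  rw [← LinearMap.ker_eq_bot, LinearMap.ker_eq_bot']
  intro x hx
  have h : ∀ y, lorB x y = 0 := fun y => by rw [← hL, hx]; simp [lorB]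
  have h' := h ![-x 0, -x 1, x 2]
  simp [lorB] at h'
  funext i
  fin_cases i <;> simp <;> nlinarith [sq_nonneg (x 0), sq_nonneg (x 1), sq_nonneg (x 2)]

lemma lorentz_inverse_cone {L : (Fin 3 → ℝ) →ₗ[ℝ] (Fin 3 → ℝ)}
    (hL : ∀ x y : Fin 3 → ℝ, lorB (L x) (L y) = lorB x y)
    (hcone : ∀ ξ : Fin 3 → ℝ, lorB ξ ξ = 0 → 0 < ξ 2 → 0 < L ξ 2)
    {x : Fin 3 → ℝ} (hx : lorB (L x) (L x) = 0) (h2 : 0 < L x 2) : 0 < x 2 := by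
  rw [hL] at hx
  rcases lt_trichotomy (x 2) 0 with h | h | h
  · have := hcone (-x) (by simpa [lorB] using hx) (by simpa using h)
    simp at this
    linarith
  · have h0 : x = 0 := by
      simp [lorB, h] at hx
      funext i
      fin_cases i <;> simp [h] <;> nlinarith [sq_nonneg (x 0), sq_nonneg (x 1)]
    simp [h0] at h2
  · exact h

lemma lorentz_gram {L : (Fin 3 → ℝ) →ₗ[ℝ] (Fin 3 → ℝ)}
    (hL : ∀ x y : Fin 3 → ℝ, lorB (L x) (L y) = lorB x y) :
    (LinearMap.toMatrix' L).transpose * Matrix.diagonal ![-1, -1, 1] * LinearMap.toMatrix' L =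
      Matrix.diagonal ![-1, -1, 1] := by
  ext i j
  have h := hL (Pi.single i 1) (Pi.single j 1)
  rw [Matrix.mul_apply]
  simp only [Matrix.mul_diagonal, Matrix.transpose_apply, LinearMap.toMatrix'_apply,
    Fin.sum_univ_three]
  simp only [lorB] at h
  trans lorB (Pi.single i 1) (Pi.single j 1)
  · simp only [lorB, ← h]
    simp
    ring
  · fin_cases i <;> fin_cases j <;> simp [lorB, Matrix.diagonal]

/-- The action of a linear map on the upper light cone, read in the plane. -/
noncomputable def coneAction (L : (Fin 3 → ℝ) →ₗ[ℝ] (Fin 3 → ℝ)) (u : ℝ × ℝ) : ℝ × ℝ :=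
  (L (coneLift u) 0, L (coneLift u) 1)

lemma linearMap_coneLift (L : (Fin 3 → ℝ) →ₗ[ℝ] (Fin 3 → ℝ)) (u : ℝ × ℝ) (i : Fin 3) :
    L (coneLift u) i = LinearMap.toMatrix' L i 0 * u.1 + LinearMap.toMatrix' L i 1 * u.2 +
      LinearMap.toMatrix' L i 2 * Real.sqrt (u.1 ^ 2 + u.2 ^ 2) := by
  rw [← LinearMap.toMatrix'_mulVec]
  simp [Matrix.mulVec, dotProduct, Fin.sum_univ_three, coneLift]

lemma hasFDerivAt_linearMap_coneLift (L : (Fin 3 → ℝ) →ₗ[ℝ] (Fin 3 → ℝ)) {u : ℝ × ℝ}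
    (hu : u ≠ 0) (i : Fin 3) :
    HasFDerivAt (fun u => L (coneLift u) i)
      ((LinearMap.toMatrix' L i 0 +
          LinearMap.toMatrix' L i 2 * (u.1 / Real.sqrt (u.1 ^ 2 + u.2 ^ 2))) •
            ContinuousLinearMap.fst ℝ ℝ ℝ +
        (LinearMap.toMatrix' L i 1 +
          LinearMap.toMatrix' L i 2 * (u.2 / Real.sqrt (u.1 ^ 2 + u.2 ^ 2))) •
            ContinuousLinearMap.snd ℝ ℝ ℝ) u := by
  simp only [linearMap_coneLift]
  have h1 : HasFDerivAt (fun u : ℝ × ℝ => u.1) (ContinuousLinearMap.fst ℝ ℝ ℝ) u :=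
    hasFDerivAt_fst
  have h2 : HasFDerivAt (fun u : ℝ × ℝ => u.2) (ContinuousLinearMap.snd ℝ ℝ ℝ) u :=
    hasFDerivAt_snd
  have h3 := ((h1.pow 2).add (h2.pow 2)).sqrt (sq_add_sq_pos_of_ne_zero hu).ne'
  have hr := (Real.sqrt_pos.2 (sq_add_sq_pos_of_ne_zero hu)).ne'
  refine (((h1.const_mul _).add (h2.const_mul _)).add (h3.const_mul _)).congr_fderiv ?_
  ext <;> simp <;> field_simp <;> simp

lemma det_prod_linear_forms (a b c d : ℝ) :
    ((a • ContinuousLinearMap.fst ℝ ℝ ℝ + b • ContinuousLinearMap.snd ℝ ℝ ℝ).prod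
      (c • ContinuousLinearMap.fst ℝ ℝ ℝ + d • ContinuousLinearMap.snd ℝ ℝ ℝ)).det =
      a * d - b * c := by
  rw [ContinuousLinearMap.det, ← LinearMap.det_toMatrix (Module.Basis.finTwoProd ℝ),
    Matrix.det_fin_two]
  simp [LinearMap.toMatrix_apply]

/-- The Jacobian of the action of a Lorentz map on the cone, in the planar chart. -/
lemma exists_hasFDerivAt_coneAction {L : (Fin 3 → ℝ) →ₗ[ℝ] (Fin 3 → ℝ)}
    (hL : ∀ x y : Fin 3 → ℝ, lorB (L x) (L y) = lorB x y) {u : ℝ × ℝ} (hu : u ≠ 0) :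
    ∃ T : ℝ × ℝ →L[ℝ] ℝ × ℝ, HasFDerivAt (coneAction L) T u ∧
      |T.det| = |L (coneLift u) 2| / coneLift u 2 := by
  refine ⟨_, (hasFDerivAt_linearMap_coneLift L hu 0).prodMk
    (hasFDerivAt_linearMap_coneLift L hu 1), ?_⟩
  obtain ⟨hd, h2, h0, h1⟩ := lorentz_cofactors _ (lorentz_gram hL)
  rw [det_prod_linear_forms, ← abs_of_pos (coneLift_two_pos hu), ← abs_div,
    ← one_mul |_ / _|, ← hd, ← abs_mul, linearMap_coneLift]
  have hr := Real.sqrt_pos.2 (sq_add_sq_pos_of_ne_zero hu)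
  have hc : coneLift u 2 = Real.sqrt (u.1 ^ 2 + u.2 ^ 2) := by simp [coneLift]
  rw [hc]
  congr 1
  generalize LinearMap.toMatrix' L = M at *
  generalize Real.sqrt (u.1 ^ 2 + u.2 ^ 2) = r at *
  field_simp
  linear_combination r * (r * h2 - u.1 * h0 - u.2 * h1)

lemma coneLift_coneAction {L : (Fin 3 → ℝ) →ₗ[ℝ] (Fin 3 → ℝ)}
    (hL : ∀ x y : Fin 3 → ℝ, lorB (L x) (L y) = lorB x y)
    (hcone : ∀ ξ : Fin 3 → ℝ, lorB ξ ξ = 0 → 0 < ξ 2 → 0 < L ξ 2) {u : ℝ × ℝ} (hu : u ≠ 0) :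
    coneLift (coneAction L u) = L (coneLift u) :=
  coneLift_eq (by rw [hL, lorB_coneLift]) (hcone _ (lorB_coneLift u) (coneLift_two_pos hu)).le

lemma coneLift_injective : Function.Injective coneLift := fun u v h =>
  Prod.ext (by simpa [coneLift] using congrFun h 0) (by simpa [coneLift] using congrFun h 1)

lemma injOn_coneAction {L : (Fin 3 → ℝ) →ₗ[ℝ] (Fin 3 → ℝ)}
    (hL : ∀ x y : Fin 3 → ℝ, lorB (L x) (L y) = lorB x y)
    (hcone : ∀ ξ : Fin 3 → ℝ, lorB ξ ξ = 0 → 0 < ξ 2 → 0 < L ξ 2) :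
    Set.InjOn (coneAction L) {u | u ≠ 0} := by
  intro u hu v hv h
  apply coneLift_injective
  apply lorentz_injective hL
  rw [← coneLift_coneAction hL hcone hu, ← coneLift_coneAction hL hcone hv, h]

lemma image_coneAction {L : (Fin 3 → ℝ) →ₗ[ℝ] (Fin 3 → ℝ)}
    (hL : ∀ x y : Fin 3 → ℝ, lorB (L x) (L y) = lorB x y)
    (hcone : ∀ ξ : Fin 3 → ℝ, lorB ξ ξ = 0 → 0 < ξ 2 → 0 < L ξ 2) :
    coneAction L '' {u | u ≠ 0} = {u | u ≠ 0} := by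
  apply Set.Subset.antisymm
  · rintro _ ⟨u, hu, rfl⟩
    exact ne_zero_of_lorB_eq_zero (by rw [hL, lorB_coneLift])
      (hcone _ (lorB_coneLift u) (coneLift_two_pos hu)).ne'
  · intro v hv
    obtain ⟨x, hx⟩ := LinearMap.injective_iff_surjective.1 (lorentz_injective hL) (coneLift v)
    have hB : lorB (L x) (L x) = 0 := by rw [hx, lorB_coneLift]
    have h2 : 0 < x 2 :=
      lorentz_inverse_cone hL hcone hB (by rw [hx]; exact coneLift_two_pos hv)
    rw [hL] at hB
    refine ⟨(x 0, x 1), ne_zero_of_lorB_eq_zero hB h2.ne', ?_⟩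
    rw [coneAction, coneLift_eq hB h2.le, hx]
    simp [coneLift]

lemma horoMeasure_apply {A : Set (Fin 3 → ℝ)} (hA : MeasurableSet A) :
    horoMeasure A = ∫⁻ u in {u : ℝ × ℝ | u ≠ 0},
      (coneLift ⁻¹' A).indicator (fun u => ENNReal.ofReal (1 / coneLift u 2)) u := by
  have h : horoMeasure = Measure.map coneLift
      (((volume : Measure (ℝ × ℝ)).restrict {u : ℝ × ℝ | u ≠ 0}).withDensity
        fun u : ℝ × ℝ => ENNReal.ofReal (1 / coneLift u 2)) := rfl
  rw [h, Measure.map_apply measurable_coneLift hA,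
    withDensity_apply _ (measurable_coneLift hA),
    lintegral_indicator (measurable_coneLift hA)]

/-- **The measure `(dξ₁ ∧ dξ₂)/ξ₃` on the upper light cone is Lorentz-invariant.**
If `L` is a linear map of `ℝ³` preserving the Lorentzian form `B` and mapping the upper
light cone into itself, then the pushforward of `horoMeasure` under `L` is
`horoMeasure`. -/
theorem stmt16 (L : (Fin 3 → ℝ) →ₗ[ℝ] (Fin 3 → ℝ))
    (hL : ∀ x y : Fin 3 → ℝ, lorB (L x) (L y) = lorB x y)
    (hcone : ∀ ξ : Fin 3 → ℝ, lorB ξ ξ = 0 → 0 < ξ 2 → 0 < L ξ 2) :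
    Measure.map L horoMeasure = horoMeasure := by
  ext A hA
  have hLm : Measurable L := L.continuous_of_finiteDimensional.measurable
  rw [Measure.map_apply hLm hA, horoMeasure_apply (hLm hA), horoMeasure_apply hA]
  have hs : MeasurableSet {u : ℝ × ℝ | u ≠ 0} := (measurableSet_singleton 0).compl
  choose! T hT hdet using fun (u : ℝ × ℝ) (hu : u ∈ {u : ℝ × ℝ | u ≠ 0}) =>
    exists_hasFDerivAt_coneAction hL hu
  conv_rhs => rw [← image_coneAction hL hcone]
  rw [lintegral_image_eq_lintegral_abs_det_fderiv_mul volume hs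
    (fun u hu => (hT u hu).hasFDerivWithinAt) (injOn_coneAction hL hcone)]
  refine setLIntegral_congr_fun hs fun u hu => ?_
  have hlift := coneLift_coneAction hL hcone hu
  have hpos := hcone _ (lorB_coneLift u) (coneLift_two_pos hu)
  have hmem : coneAction L u ∈ coneLift ⁻¹' A ↔ u ∈ coneLift ⁻¹' (L ⁻¹' A) := by
    simp [hlift]
  by_cases h : u ∈ coneLift ⁻¹' (L ⁻¹' A)
  · simp only [Set.indicator_of_mem h, Set.indicator_of_mem (hmem.2 h)]
    rw [← ENNReal.ofReal_mul (abs_nonneg _), hdet u hu, hlift, abs_of_pos hpos]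
    congr 1
    field_simp
  · simp [Set.indicator_of_notMem h, Set.indicator_of_notMem (fun h' => h (hmem.1 h'))]
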